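/- Let m ∈ ℝ, ρ, δ ≥ 0, and let σ ∈ S^m_{ρ,δ}. Let α be a nonnegative integer and let Φ be a Schwartz function on ℝⁿ of the form Φ = ∂_{x₁}^α Φ_α for some Schwartz Φ_α, and let Ψ be a Schwartz function on ℝⁿ. For integers j ≥ 0 and k, k′ ∈ ℤⁿ define a_{j,k,k′} = ∫_{ℝⁿ}∫_{ℝⁿ} σ(x,ξ) · 2^{nj/2} Φ(2^j x − k) · Ψ(ξ − k′) dx dξ. Then for every multi-index β ∈ ℕⁿ there exists a constant C_{α,β} such that for all j, k, k′: |Δ^β a_{j,k,k′}| ≤ C_{α,β} 2^{−(n/2+α)j} (1+|k′|)^{m + δα − ρ|β|}, where Δ^β denotes the iterated forward difference in the index k′. -/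

import Mathlib

open MeasureTheory Complex
open scoped RealInnerProductSpace ENNReal NNReal

noncomputable section

abbrev En (n : ℕ) : Type := EuclideanSpace ℝ (Fin n)

/-- Image of an integer vector `k ∈ ℤⁿ` in `ℝⁿ`. -/
def intVec (n : ℕ) (k : Fin n → ℤ) : En n :=
  (EuclideanSpace.equiv (Fin n) ℝ).symm fun i => (k i : ℝ)

/-- The unit coordinate vector `eᵢ` of `ℝⁿ`. -/
def unitE (n : ℕ) (i : Fin n) : En n := EuclideanSpace.single i 1

/-- Iterated directional (partial) derivative along the list of directions `L`. -/
def pdSeq {V : Type*} [NormedAddCommGroup V] [NormedSpace ℝ V] (L : List V) (f : V → ℂ) :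
    V → ℂ :=
  L.foldr (fun v g => fun x => fderiv ℝ g x v) f

/-- The list of directions encoding the multi-index `α`: direction `dir i` repeated `α i`
times. -/
def dirList {V : Type*} {n : ℕ} (α : Fin n → ℕ) (dir : Fin n → V) : List V :=
  (List.ofFn fun i => List.replicate (α i) (dir i)).flatten

/-- The mixed partial derivative `∂_x^α ∂_ξ^β σ` of a symbol `σ(x,ξ)` on `ℝⁿ × ℝⁿ`. -/
def mixD (n : ℕ) (α β : Fin n → ℕ) (σ : En n × En n → ℂ) : En n × En n → ℂ :=
  pdSeq (dirList α (fun i => (unitE n i, (0 : En n))) ++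
    dirList β (fun i => ((0 : En n), unitE n i))) σ

/-- The Hörmander class `S^m_{ρ,δ}`: `σ` is smooth and
`|∂_x^α ∂_ξ^β σ(x,ξ)| ≤ C_{α,β} (1+|ξ|)^{m − ρ|β| + δ|α|}`. -/
def IsHormander (n : ℕ) (m ρ δ : ℝ) (σ : En n × En n → ℂ) : Prop :=
  ContDiff ℝ (⊤ : ℕ∞) σ ∧
  ∀ α β : Fin n → ℕ, ∃ C : ℝ, ∀ x ξ : En n,
    ‖mixD n α β σ (x, ξ)‖ ≤
      C * (1 + ‖ξ‖) ^ (m - ρ * (∑ i, (β i : ℝ)) + δ * (∑ i, (α i : ℝ)))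

/-- The difference operator `Δ_h g(X) = g(X+h) − g(X)`. -/
def idiff {V : Type*} [Add V] (h : V) (g : V → ℂ) : V → ℂ := fun X => g (X + h) - g X

/-- The Besov `B^{α,∞}_∞` norm (valued in `ℝ≥0∞`):
`‖g‖_∞ + sup_{h≠0} |h|^{−α} ‖Δ_h^{α+1} g‖_∞`. -/
def besovE (n : ℕ) (α : ℕ) (g : En n → ℂ) : ℝ≥0∞ :=
  (⨆ x, (‖g x‖₊ : ℝ≥0∞)) +
    ⨆ (h : En n) (_ : h ≠ 0),
      ((‖h‖₊ : ℝ≥0∞) ^ (α : ℝ))⁻¹ * ⨆ x, (‖(idiff h)^[α + 1] g x‖₊ : ℝ≥0∞)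

/-- The partial derivative `∂_ξ^β σ` in the `ξ`-variables only. -/
def xiD (n : ℕ) (β : Fin n → ℕ) (σ : En n × En n → ℂ) : En n → En n → ℂ :=
  fun x => pdSeq (dirList β (unitE n)) (fun ξ => σ (x, ξ))

/-- The class `S̃^m_{ρ,δ}`: `σ(x,ξ)` is smooth in `ξ`, its `ξ`-derivatives are continuous,
and `‖∂_ξ^β σ(·,ξ)‖_{B^{α,∞}_∞} ≤ C_{α,β} (1+|ξ|)^{m − ρ|β| + δα}` (the Besov norm taken in
the `x`-variable). -/
def IsTilde (n : ℕ) (m ρ δ : ℝ) (σ : En n × En n → ℂ) : Prop :=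
  (∀ x : En n, ContDiff ℝ (⊤ : ℕ∞) fun ξ => σ (x, ξ)) ∧
  (∀ β : Fin n → ℕ, Continuous fun X : En n × En n => xiD n β σ X.1 X.2) ∧
  ∀ (β : Fin n → ℕ) (α : ℕ), ∃ C : ℝ, ∀ ξ : En n,
    besovE n α (fun x => xiD n β σ x ξ) ≤
      ENNReal.ofReal (C * (1 + ‖ξ‖) ^ (m - ρ * (∑ i, (β i : ℝ)) + δ * α))

/-- The forward difference `Δᵢ b (k) = b(k+eᵢ) − b(k)` on families indexed by `ℤⁿ`. -/
def fdiffI (n : ℕ) (i : Fin n) (b : (Fin n → ℤ) → ℂ) : (Fin n → ℤ) → ℂ :=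
  fun k => b (k + Pi.single i 1) - b k

/-- The iterated forward difference `Δ^β = Δ₁^{β₁} ⋯ Δₙ^{βₙ}`. -/
def fdiffM (n : ℕ) (β : Fin n → ℕ) (b : (Fin n → ℤ) → ℂ) : (Fin n → ℤ) → ℂ :=
  ((List.ofFn fun i : Fin n => (fdiffI n i)^[β i]).foldr (· ∘ ·) id) b


set_option linter.unusedSectionVars false

section Calc
variable {V : Type*} [NormedAddCommGroup V] [NormedSpace ℝ V]

lemma pdSeq_cons (v : V) (L : List V) (f : V → ℂ) :
    pdSeq (v :: L) f = fun x => fderiv ℝ (pdSeq L f) x v := rfl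

lemma pdSeq_nil (f : V → ℂ) : pdSeq [] f = f := rfl

lemma pdSeq_append (L M : List V) (f : V → ℂ) : pdSeq (L ++ M) f = pdSeq L (pdSeq M f) := by
  simp [pdSeq, List.foldr_append]

lemma contDiff_fderiv_dir {f : V → ℂ} (hf : ContDiff ℝ (⊤ : ℕ∞) f) (v : V) :
    ContDiff ℝ (⊤ : ℕ∞) (fun x => fderiv ℝ f x v) :=
  (hf.fderiv_right (m := (⊤ : ℕ∞)) (by simp)).clm_apply contDiff_const

lemma contDiff_pdSeq {f : V → ℂ} (hf : ContDiff ℝ (⊤ : ℕ∞) f) (L : List V) :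
    ContDiff ℝ (⊤ : ℕ∞) (pdSeq L f) := by
  induction L with
  | nil => exact hf
  | cons v L ih => exact contDiff_fderiv_dir ih v

lemma fderiv_dir_comm {f : V → ℂ} (hf : ContDiff ℝ (⊤ : ℕ∞) f) (v w : V) (x : V) :
    fderiv ℝ (fun y => fderiv ℝ f y v) x w = fderiv ℝ (fun y => fderiv ℝ f y w) x v := by
  have hd : DifferentiableAt ℝ (fderiv ℝ f) x :=
    ((hf.fderiv_right (m := (⊤ : ℕ∞)) (by simp)).differentiable (by simp)) x
  have hs : IsSymmSndFDerivAt ℝ f x := hf.contDiffAt.isSymmSndFDerivAt (by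
    simp only [minSmoothness_of_isRCLikeNormedField]; 
    exact WithTop.coe_le_coe.2 (le_top : (2 : ℕ∞) ≤ ⊤))
  rw [fderiv_clm_apply hd (by fun_prop), fderiv_clm_apply hd (by fun_prop)]
  simpa using hs w v

lemma pdSeq_perm {L M : List V} (h : L.Perm M) {f : V → ℂ} (hf : ContDiff ℝ (⊤ : ℕ∞) f) :
    pdSeq L f = pdSeq M f := by
  induction h with
  | nil => rfl
  | cons v _ ih => rw [pdSeq_cons, pdSeq_cons, ih]
  | swap v w L =>
    funext x
    exact fderiv_dir_comm (contDiff_pdSeq hf L) v w x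
  | trans _ _ h1 h2 => rw [h1, h2]

lemma contDiff_idiff {f : V → ℂ} (hf : ContDiff ℝ (⊤ : ℕ∞) f) (v : V) :
    ContDiff ℝ (⊤ : ℕ∞) (idiff v f) :=
  (hf.comp (contDiff_id.add contDiff_const)).sub hf

lemma pdSeq_idiff {f : V → ℂ} (hf : ContDiff ℝ (⊤ : ℕ∞) f) (v : V) (L : List V) :
    pdSeq L (idiff v f) = idiff v (pdSeq L f) := by
  induction L with
  | nil => rfl
  | cons w L ih =>
    have hg := (contDiff_pdSeq hf L).differentiable (by simp)
    funext x
    rw [pdSeq_cons, pdSeq_cons, ih]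
    change fderiv ℝ (fun y => pdSeq L f (y + v) - pdSeq L f y) x w = _
    have h1 : DifferentiableAt ℝ (fun y => pdSeq L f (y + v)) x :=
      (hg (x + v)).comp x (differentiableAt_id.add_const v)
    rw [fderiv_fun_sub h1 (hg x), fderiv_comp_add_right]
    rfl

/-- Iterated differences. -/
def dSeq (L : List V) (f : V → ℂ) : V → ℂ := L.foldr (fun v g => idiff v g) f

lemma dSeq_cons (v : V) (L : List V) (f : V → ℂ) : dSeq (v :: L) f = idiff v (dSeq L f) := rfl

lemma idiff_comm (v w : V) (f : V → ℂ) : idiff v (idiff w f) = idiff w (idiff v f) := by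
  funext x
  simp only [idiff]
  rw [add_right_comm]
  ring

lemma dSeq_idiff (v : V) (L : List V) (f : V → ℂ) : idiff v (dSeq L f) = dSeq L (idiff v f) := by
  induction L with
  | nil => rfl
  | cons w L ih => rw [dSeq_cons, dSeq_cons, idiff_comm, ih]

lemma norm_idiff_le {g : V → ℂ} (hg : ContDiff ℝ (⊤ : ℕ∞) g) (v X : V) (C : ℝ)
    (h : ∀ t : ℝ, 0 ≤ t → t ≤ 1 → ‖fderiv ℝ g (X + t • v) v‖ ≤ C) :
    ‖idiff v g X‖ ≤ C := by
  have hd : ∀ t : ℝ, HasDerivAt (fun s : ℝ => g (X + s • v)) (fderiv ℝ g (X + t • v) v) t := by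
    intro t
    have h1 : HasFDerivAt g (fderiv ℝ g (X + t • v)) (X + t • v) :=
      (hg.differentiable (by simp) _).hasFDerivAt
    have h2 : HasDerivAt (fun s : ℝ => X + s • v) v t := by
      simpa using ((hasDerivAt_id t).smul_const v).const_add X
    exact h1.comp_hasDerivAt t h2
  have := norm_image_sub_le_of_norm_deriv_le_segment_01' (f := fun s : ℝ => g (X + s • v))
    (fun t _ => (hd t).hasDerivWithinAt) (fun t ht => h t ht.1 ht.2.le)
  simpa [idiff] using this

end Calc

lemma peetre {E : Type*} [NormedAddCommGroup E] (M : ℝ) (x y : E) :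
    (1 + ‖x + y‖) ^ M ≤ (1 + ‖x‖) ^ M * (1 + ‖y‖) ^ |M| := by
  have hx := norm_nonneg x
  have hy := norm_nonneg y
  have hxy := norm_nonneg (x + y)
  rcases le_or_gt 0 M with h | h
  · rw [abs_of_nonneg h, ← Real.mul_rpow (by positivity) (by positivity)]
    apply Real.rpow_le_rpow (by positivity) _ h
    nlinarith [norm_add_le x y, mul_nonneg hx hy]
  · rw [abs_of_neg h, Real.rpow_neg (by positivity), ← div_eq_mul_inv,
      ← Real.div_rpow (by positivity) (by positivity)]
    apply Real.rpow_le_rpow_of_nonpos (by positivity) _ h.le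
    rw [div_le_iff₀ (by positivity)]
    have : ‖x‖ ≤ ‖x + y‖ + ‖y‖ := by
      simpa using norm_sub_le (x + y) y
    nlinarith [mul_nonneg hxy hy]

section Prod
variable {E F : Type*} [NormedAddCommGroup E] [NormedSpace ℝ E]
  [NormedAddCommGroup F] [NormedSpace ℝ F]

lemma dSeq_bound (M : ℝ) (L : List F) (hL : ∀ v ∈ L, ‖v‖ ≤ 1) (C : ℝ) (hC : 0 ≤ C) :
    ∀ (σ : E × F → ℂ), ContDiff ℝ (⊤ : ℕ∞) σ →
    (∀ x ξ, ‖pdSeq (L.map fun v => ((0 : E), v)) σ (x, ξ)‖ ≤ C * (1 + ‖ξ‖) ^ M) →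
    ∀ x ξ, ‖dSeq (L.map fun v => ((0 : E), v)) σ (x, ξ)‖ ≤
      C * ((2 : ℝ) ^ |M|) ^ L.length * (1 + ‖ξ‖) ^ M := by
  induction L generalizing C with
  | nil => intro σ _ h x ξ; simpa [dSeq, pdSeq] using h x ξ
  | cons v L ih =>
    intro σ hσ h x ξ
    have hv : ‖v‖ ≤ 1 := hL v (by simp)
    simp only [List.map_cons]
    rw [dSeq_cons, dSeq_idiff]
    have := ih (fun w hw => hL w (by simp [hw])) (C * 2 ^ |M|) (by positivity)
      (idiff (0, v) σ) (contDiff_idiff hσ _) ?_ x ξ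
    · refine this.trans (le_of_eq ?_)
      rw [List.length_cons, pow_succ]; ring
    · intro x ξ
      rw [pdSeq_idiff hσ]
      apply norm_idiff_le (contDiff_pdSeq hσ _)
      intro t ht0 ht1
      have := h (x + t • 0) (ξ + t • v)
      refine (by simpa [pdSeq_cons] using this : _ ≤ C * (1 + ‖ξ + t • v‖) ^ M).trans ?_
      rw [mul_assoc]
      apply mul_le_mul_of_nonneg_left _ hC
      rw [mul_comm]
      refine (peetre M ξ (t • v)).trans ?_
      apply mul_le_mul_of_nonneg_left _ (by positivity)
      apply Real.rpow_le_rpow (by positivity) _ (abs_nonneg _)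
      have : ‖t • v‖ ≤ 1 := by
        rw [norm_smul, Real.norm_of_nonneg ht0]
        exact mul_le_one₀ ht1 (norm_nonneg _) hv
      linarith

lemma pdSeq_slice {σ : E × F → ℂ} (hσ : ContDiff ℝ (⊤ : ℕ∞) σ) (L : List E) (ξ : F) :
    pdSeq L (fun x => σ (x, ξ)) = fun x => pdSeq (L.map fun v => (v, (0 : F))) σ (x, ξ) := by
  induction L with
  | nil => rfl
  | cons v L ih =>
    funext x
    rw [pdSeq_cons, ih, List.map_cons, pdSeq_cons]
    have hg := (contDiff_pdSeq hσ (L.map fun v => (v, (0 : F)))).differentiable (by simp) (x, ξ)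
    have h2 : HasFDerivAt (fun y : E => (y, ξ)) (ContinuousLinearMap.inl ℝ E F) x :=
      hasFDerivAt_prodMk_left x ξ
    have := (hg.hasFDerivAt.comp x h2).fderiv
    simp only [Function.comp_def] at this
    change fderiv ℝ (fun x => pdSeq (List.map (fun v => (v, (0 : F))) L) σ (x, ξ)) x v = _
    rw [this]
    simp

end Prod

section Integrals
variable {n : ℕ}

lemma weight_integrable (Ψ : SchwartzMap (En n) ℂ) (s : ℝ) :
    Integrable (fun ξ : En n => (1 + ‖ξ‖) ^ s * ‖Ψ ξ‖) := by
  obtain ⟨N, hN⟩ := exists_nat_ge s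
  have h1 : Integrable (fun ξ : En n => (1 + ‖ξ‖) ^ N * ‖Ψ ξ‖) := by
    have : (fun ξ : En n => (1 + ‖ξ‖) ^ N * ‖Ψ ξ‖) =
        fun ξ => ∑ k ∈ Finset.range (N + 1), (N.choose k : ℝ) * (‖ξ‖ ^ k * ‖Ψ ξ‖) := by
      funext ξ
      rw [add_comm, add_pow, Finset.sum_mul]
      refine Finset.sum_congr rfl fun k _ => ?_
      simp; ring
    rw [this]
    exact integrable_finsetSum _ fun k _ => (Ψ.integrable_pow_mul volume k).const_mul _
  refine h1.mono' ?_ (Filter.Eventually.of_forall fun ξ => ?_)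
  · have hc : Continuous fun ξ : En n => (1 + ‖ξ‖) ^ s * ‖Ψ ξ‖ := by
      refine Continuous.mul ?_ Ψ.continuous.norm
      exact Continuous.rpow_const (by fun_prop) fun ξ => Or.inl (by positivity)
    exact hc.aestronglyMeasurable
  · rw [Real.norm_of_nonneg (by positivity), ← Real.rpow_natCast]
    gcongr
    simp

/-- Continuous symbols of polynomial growth. -/
def TC (τ : En n × En n → ℂ) : Prop :=
  Continuous τ ∧ ∃ C M : ℝ, 0 ≤ C ∧ 0 ≤ M ∧ ∀ x ξ, ‖τ (x, ξ)‖ ≤ C * (1 + ‖ξ‖) ^ M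

/-- The pairing integral. -/
def II (W : En n → ℂ) (Ψ : SchwartzMap (En n) ℂ) (τ : En n × En n → ℂ) (y : En n) : ℂ :=
  ∫ ξ : En n, ∫ x : En n, τ (x, ξ + y) * W x * Ψ ξ

lemma TC_of_bound {τ : En n × En n → ℂ} (hc : Continuous τ) {C M : ℝ}
    (h : ∀ x ξ, ‖τ (x, ξ)‖ ≤ C * (1 + ‖ξ‖) ^ M) : TC τ := by
  refine ⟨hc, |C|, |M|, abs_nonneg _, abs_nonneg _, fun x ξ => (h x ξ).trans ?_⟩
  have : (1 + ‖ξ‖) ^ M ≤ (1 + ‖ξ‖) ^ |M| :=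
    Real.rpow_le_rpow_of_exponent_le (by simp) (le_abs_self M)
  exact mul_le_mul (le_abs_self C) this (by positivity) (abs_nonneg _)

lemma TC_idiff {τ : En n × En n → ℂ} (h : TC τ) (v : En n) : TC (idiff ((0 : En n), v) τ) := by
  obtain ⟨hc, C, M, hC, hM, hb⟩ := h
  have hc' : Continuous (idiff ((0 : En n), v) τ) :=
    (hc.comp (continuous_id.add continuous_const)).sub hc
  refine TC_of_bound hc' (C := C * (1 + ‖v‖) ^ |M| + C) (M := M) fun x ξ => ?_
  simp only [idiff]
  refine (norm_sub_le _ _).trans ?_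
  rw [add_mul]
  refine add_le_add ?_ (hb x ξ)
  refine (hb _ _).trans ?_
  have := peetre M ξ v
  rw [mul_assoc]
  refine mul_le_mul_of_nonneg_left ?_ hC
  linarith

lemma TC_dSeq {τ : En n × En n → ℂ} (h : TC τ) (L : List (En n)) :
    TC (dSeq (L.map fun v => ((0 : En n), v)) τ) := by
  induction L with
  | nil => exact h
  | cons v L ih => exact TC_idiff ih v

lemma term_bound {τ : En n × En n → ℂ} {C M : ℝ} (hC : 0 ≤ C)
    (h : ∀ x ξ, ‖τ (x, ξ)‖ ≤ C * (1 + ‖ξ‖) ^ M)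
    (W : En n → ℂ) (Ψ : SchwartzMap (En n) ℂ) (y x ξ : En n) :
    ‖τ (x, ξ + y) * W x * Ψ ξ‖ ≤
      C * (1 + ‖y‖) ^ M * ((1 + ‖ξ‖) ^ |M| * ‖Ψ ξ‖) * ‖W x‖ := by
  rw [norm_mul, norm_mul]
  have h1 : ‖τ (x, ξ + y)‖ ≤ C * ((1 + ‖y‖) ^ M * (1 + ‖ξ‖) ^ |M|) := by
    refine (h _ _).trans (mul_le_mul_of_nonneg_left ?_ hC)
    rw [add_comm ξ y]
    exact peetre M y ξ
  calc _ ≤ C * ((1 + ‖y‖) ^ M * (1 + ‖ξ‖) ^ |M|) * ‖W x‖ * ‖Ψ ξ‖ := by gcongr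
    _ = _ := by ring

lemma prod_integrable {τ : En n × En n → ℂ} (h : TC τ) {W : En n → ℂ} (hWc : Continuous W)
    (hW : Integrable W) (Ψ : SchwartzMap (En n) ℂ) (y : En n) :
    Integrable (fun p : En n × En n => τ (p.2, p.1 + y) * W p.2 * Ψ p.1)
      (volume.prod volume) := by
  obtain ⟨hc, C, M, hC, hM, hb⟩ := h
  have h1 : Integrable (fun p : En n × En n =>
      (C * (1 + ‖y‖) ^ M * ((1 + ‖p.1‖) ^ |M| * ‖Ψ p.1‖)) * ‖W p.2‖) (volume.prod volume) :=
    Integrable.mul_prod ((weight_integrable Ψ |M|).const_mul _) hW.norm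
  refine h1.mono' ?_ (Filter.Eventually.of_forall fun p => term_bound hC hb W Ψ y p.2 p.1)
  have : Continuous (fun p : En n × En n => τ (p.2, p.1 + y) * W p.2 * Ψ p.1) :=
    ((hc.comp (by fun_prop)).mul (hWc.comp continuous_snd)).mul (Ψ.continuous.comp continuous_fst)
  exact this.aestronglyMeasurable

lemma slice_integrable {τ : En n × En n → ℂ} (h : TC τ) {W : En n → ℂ}
    (hW : Integrable W) (Ψ : SchwartzMap (En n) ℂ) (y ξ : En n) :
    Integrable (fun x : En n => τ (x, ξ + y) * W x * Ψ ξ) := by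
  obtain ⟨hc, C, M, hC, hM, hb⟩ := h
  refine Integrable.mul_const ?_ _
  have hcc : Continuous fun x : En n => τ (x, ξ + y) := hc.comp (by fun_prop)
  exact hW.bdd_mul (c := C * (1 + ‖ξ + y‖) ^ M) hcc.aestronglyMeasurable
    (Filter.Eventually.of_forall fun x => hb x _)

lemma II_idiff {τ : En n × En n → ℂ} (h : TC τ) {W : En n → ℂ} (hWc : Continuous W)
    (hW : Integrable W) (Ψ : SchwartzMap (En n) ℂ) (y v : En n) :
    II W Ψ τ (y + v) - II W Ψ τ y = II W Ψ (idiff ((0 : En n), v) τ) y := by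
  unfold II
  rw [← integral_sub (prod_integrable h hWc hW Ψ (y + v)).integral_prod_left
    (prod_integrable h hWc hW Ψ y).integral_prod_left]
  congr 1
  funext ξ
  simp only
  rw [← integral_sub (slice_integrable h hW Ψ (y + v) ξ) (slice_integrable h hW Ψ y ξ)]
  congr 1
  funext x
  simp only [idiff, Prod.mk_add_mk, add_zero, add_assoc]
  ring

lemma II_bound {τ : En n × En n → ℂ} {C M : ℝ} (hC : 0 ≤ C)
    (h : ∀ x ξ, ‖τ (x, ξ)‖ ≤ C * (1 + ‖ξ‖) ^ M) {W : En n → ℂ}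
    (hW : Integrable W) (Ψ : SchwartzMap (En n) ℂ) (y : En n) :
    ‖II W Ψ τ y‖ ≤ C * (1 + ‖y‖) ^ M * (∫ ξ, (1 + ‖ξ‖) ^ |M| * ‖Ψ ξ‖) * ∫ x, ‖W x‖ := by
  have h1 : ∀ ξ, ‖∫ x : En n, τ (x, ξ + y) * W x * Ψ ξ‖ ≤
      C * (1 + ‖y‖) ^ M * ((1 + ‖ξ‖) ^ |M| * ‖Ψ ξ‖) * ∫ x, ‖W x‖ := by
    intro ξ
    rw [← integral_const_mul]
    exact norm_integral_le_of_norm_le (hW.norm.const_mul _)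
      (Filter.Eventually.of_forall fun x => term_bound hC h W Ψ y x ξ)
  unfold II
  refine (norm_integral_le_of_norm_le
    (((weight_integrable Ψ |M|).const_mul _).mul_const _)
    (Filter.Eventually.of_forall h1)).trans (le_of_eq ?_)
  rw [integral_mul_const, integral_const_mul]

lemma unitE_norm (i : Fin n) : ‖unitE n i‖ = 1 := by simp [unitE]

lemma intVec_add_single (k : Fin n → ℤ) (i : Fin n) :
    intVec n (k + Pi.single i 1) = intVec n k + unitE n i := by
  ext l
  by_cases hl : l = i
  · subst hl; simp [intVec, unitE]
  · simp [intVec, unitE, hl]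

lemma fdiff_II {τ : En n × En n → ℂ} (h : TC τ) {W : En n → ℂ} (hWc : Continuous W)
    (hW : Integrable W) (Ψ : SchwartzMap (En n) ℂ) (L : List (Fin n)) :
    L.foldr (fdiffI n) (fun k => II W Ψ τ (intVec n k)) =
      fun k => II W Ψ (dSeq ((L.map (unitE n)).map fun v => ((0 : En n), v)) τ) (intVec n k) := by
  induction L with
  | nil => rfl
  | cons i L ih =>
    funext k
    rw [List.foldr_cons, ih]
    simp only [fdiffI, intVec_add_single, List.map_cons]
    rw [dSeq_cons, ← II_idiff (TC_dSeq h _) hWc hW]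

lemma fdiffM_eq (β : Fin n → ℕ) (b : (Fin n → ℤ) → ℂ) :
    fdiffM n β b = (dirList β (fun i => i)).foldr (fdiffI n) b := by
  unfold fdiffM dirList
  rw [List.ofFn_eq_map, List.ofFn_eq_map]
  have hrep : ∀ (i : Fin n) (N : ℕ) (c : (Fin n → ℤ) → ℂ),
      (List.replicate N i).foldr (fdiffI n) c = (fdiffI n i)^[N] c := by
    intro i N c
    induction N with
    | zero => rfl
    | succ N ih => rw [List.replicate_succ, List.foldr_cons, ih, Function.iterate_succ_apply']
  generalize List.finRange n = l
  induction l with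
  | nil => rfl
  | cons i l ih =>
    rw [List.map_cons, List.map_cons, List.flatten_cons, List.foldr_append, ← ih,
      List.foldr_cons, hrep]
    rfl

lemma dirList_map {V : Type*} (β : Fin n → ℕ) (dir : Fin n → V) :
    dirList β dir = (dirList β (fun i => i)).map dir := by
  unfold dirList
  rw [List.map_flatten, List.map_ofFn]
  congr 2
  funext i
  simp

lemma dirList_zero {V : Type*} (dir : Fin n → V) : dirList 0 dir = [] := by
  simp [dirList]

lemma dirList_single {V : Type*} (hn : 0 < n) (a : ℕ) (dir : Fin n → V) :
    dirList (Pi.single ⟨0, hn⟩ a) dir = List.replicate a (dir ⟨0, hn⟩) := by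
  obtain ⟨p, rfl⟩ : ∃ p, n = p + 1 := ⟨n - 1, by omega⟩
  unfold dirList
  rw [List.ofFn_succ]
  have : (⟨0, hn⟩ : Fin (p + 1)) = 0 := rfl
  simp [this, Fin.succ_ne_zero]

lemma exists_schwartz_pdSeq (Φ : SchwartzMap (En n) ℂ) (L : List (En n)) :
    ∃ S : SchwartzMap (En n) ℂ, ⇑S = pdSeq L ⇑Φ := by
  induction L with
  | nil => exact ⟨Φ, rfl⟩
  | cons v L ih =>
    obtain ⟨S, hS⟩ := ih
    refine ⟨LineDeriv.lineDerivOp v S, ?_⟩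
    funext x
    rw [SchwartzMap.lineDerivOp_apply_eq_fderiv, hS]
    rfl

lemma schwartz_scale_integrable (S : SchwartzMap (En n) ℂ) {r : ℝ} (hr : r ≠ 0) (c : En n) :
    Integrable (fun x : En n => S (r • x - c)) :=
  (S.integrable.comp_sub_right c).comp_smul hr

lemma ibp (S : SchwartzMap (En n) ℂ) {r : ℝ} (hr : r ≠ 0) (c e : En n) {f : En n → ℂ}
    (hf : ContDiff ℝ (⊤ : ℕ∞) f) {B B' : ℝ} (hB : ∀ x, ‖f x‖ ≤ B)
    (hB' : ∀ x, ‖fderiv ℝ f x e‖ ≤ B') :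
    ∫ x, f x * fderiv ℝ S (r • x - c) e = -(r : ℂ)⁻¹ * ∫ x, fderiv ℝ f x e * S (r • x - c) := by
  have hd : ∀ x, fderiv ℝ (fun x => S (r • x - c)) x e = (r : ℂ) * fderiv ℝ S (r • x - c) e := by
    intro x
    have h1 : HasFDerivAt S (fderiv ℝ S (r • x - c)) (r • x - c) :=
      S.differentiableAt.hasFDerivAt
    have h2 : HasFDerivAt (fun x : En n => r • x - c) (r • ContinuousLinearMap.id ℝ (En n)) x :=
      ((hasFDerivAt_id x).const_smul r).sub_const c
    have := (h1.comp x h2).fderiv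
    simp only [Function.comp_def] at this
    rw [this]
    simp
  obtain ⟨S', hS'⟩ := exists_schwartz_pdSeq S [e]
  have hS'x : ∀ z, fderiv ℝ S z e = S' z := fun z => (congrFun hS' z).symm
  have hI := schwartz_scale_integrable S hr c
  have hI' := schwartz_scale_integrable S' hr c
  have key := integral_mul_fderiv_eq_neg_fderiv_mul_of_integrable (μ := (volume : Measure (En n)))
    (f := f) (g := fun x => S (r • x - c)) (v := e)
    (hI.bdd_mul (c := B') (contDiff_fderiv_dir hf e).continuous.aestronglyMeasurable
      (Filter.Eventually.of_forall hB'))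
    (by
      simp only [hd, hS'x]
      exact (hI'.const_mul _).bdd_mul (c := B) hf.continuous.aestronglyMeasurable
        (Filter.Eventually.of_forall hB))
    (hI.bdd_mul (c := B) hf.continuous.aestronglyMeasurable
        (Filter.Eventually.of_forall hB))
    (fun x _ => hf.differentiable (by simp) x)
    (fun x _ => S.differentiableAt.comp x (by fun_prop))
  simp only [hd] at key
  have hrc : (r : ℂ) ≠ 0 := by exact_mod_cast hr
  rw [neg_mul, ← mul_neg, ← key, ← integral_const_mul]
  congr 1
  funext x
  field_simp

lemma ibp_iter (Φ : SchwartzMap (En n) ℂ) {r : ℝ} (hr : r ≠ 0) (c e : En n) (a : ℕ) :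
    ∀ f : En n → ℂ, ContDiff ℝ (⊤ : ℕ∞) f →
    (∀ l, ∃ B : ℝ, ∀ x, ‖pdSeq (List.replicate l e) f x‖ ≤ B) →
    ∫ x, f x * pdSeq (List.replicate a e) Φ (r • x - c) =
      (-(r : ℂ)⁻¹) ^ a * ∫ x, pdSeq (List.replicate a e) f x * Φ (r • x - c) := by
  induction a with
  | zero => intro f _ _; simp [pdSeq_nil]
  | succ a ih =>
    intro f hf hb
    obtain ⟨S, hS⟩ := exists_schwartz_pdSeq Φ (List.replicate a e)
    obtain ⟨B, hB⟩ := hb 0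
    obtain ⟨B', hB'⟩ := hb 1
    have hrot : ∀ l, pdSeq (List.replicate l e) (fun x => fderiv ℝ f x e) =
        pdSeq (List.replicate (l + 1) e) f := by
      intro l
      rw [List.replicate_succ', pdSeq_append]
      rfl
    have h1 := ibp S hr c e hf hB hB'
    have h2 := ih (fun x => fderiv ℝ f x e) (contDiff_fderiv_dir hf e) (fun l => by
      rw [hrot]; exact hb (l + 1))
    rw [hrot] at h2
    rw [← hS] at h2
    rw [h2] at h1
    rw [pow_succ', mul_assoc, ← h1, List.replicate_succ, pdSeq_cons, ← hS]

end Integrals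
/-- Let `σ ∈ S^m_{ρ,δ}`, let `Φ = ∂_{x₁}^α Φ_α` with `Φ_α` Schwartz, let `Ψ` be Schwartz, and
set `a_{j,k,k′} = ∫∫ σ(x,ξ) 2^{nj/2} Φ(2^j x−k) Ψ(ξ−k′) dx dξ`.  Then for every multi-index
`β` there is `C_{α,β}` with
`|Δ^β a_{j,k,k′}| ≤ C_{α,β} 2^{−(n/2+α)j} (1+|k′|)^{m+δα−ρ|β|}`, where `Δ^β` is the iterated
forward difference in `k′`. -/
theorem stmt_18 (n : ℕ) (hn : 0 < n) (m ρ δ : ℝ) (hρ : 0 ≤ ρ) (hδ : 0 ≤ δ)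
    (σ : En n × En n → ℂ) (hσ : IsHormander n m ρ δ σ)
    (α : ℕ) (Φα Ψ : SchwartzMap (En n) ℂ) :
    ∀ β : Fin n → ℕ, ∃ C : ℝ, ∀ (j : ℕ) (k k' : Fin n → ℤ),
      ‖fdiffM n β
          (fun k'' : Fin n → ℤ => ∫ ξ : En n, ∫ x : En n, σ (x, ξ) *
            ((((2 : ℝ) ^ ((n * j : ℝ) / 2) : ℝ) : ℂ) *
              pdSeq (List.replicate α (unitE n ⟨0, hn⟩)) (⇑Φα)
                ((2 : ℝ) ^ j • x - intVec n k)) *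
            Ψ (ξ - intVec n k'')) k'‖ ≤
        C * (2 : ℝ) ^ ((-(n : ℝ) / 2 - α) * j) *
          (1 + ‖intVec n k'‖) ^ (m + δ * α - ρ * (∑ i, (β i : ℝ))) := by
  intro β
  set e : En n := unitE n ⟨0, hn⟩ with he
  obtain ⟨hs, hbd⟩ := hσ
  -- bounds for pure `x`-derivatives
  have hx : ∀ l : ℕ, ∃ C M : ℝ, ∀ x ξ,
      ‖pdSeq ((List.replicate l e).map fun v => (v, (0 : En n))) σ (x, ξ)‖ ≤
        C * (1 + ‖ξ‖) ^ M := by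
    intro l
    obtain ⟨C, hC⟩ := hbd (Pi.single ⟨0, hn⟩ l) 0
    refine ⟨C, m - ρ * (∑ i, (((0 : Fin n → ℕ) i : ℕ) : ℝ)) +
      δ * (∑ i, ((Pi.single (⟨0, hn⟩ : Fin n) l : Fin n → ℕ) i : ℝ)), fun x ξ => ?_⟩
    have := hC x ξ
    rw [mixD, dirList_zero, dirList_single, List.append_nil] at this
    rw [List.map_replicate]
    exact this
  set σ' : En n × En n → ℂ := pdSeq ((List.replicate α e).map fun v => (v, (0 : En n))) σ with hσ'
  have hs' : ContDiff ℝ (⊤ : ℕ∞) σ' := contDiff_pdSeq hs _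
  have hTC : TC σ' := by
    obtain ⟨C, M, h⟩ := hx α
    exact TC_of_bound hs'.continuous h
  set L : List (Fin n) := dirList β (fun i => i) with hL
  set M : ℝ := m + δ * α - ρ * (∑ i, (β i : ℝ)) with hM
  obtain ⟨C₀, hC₀⟩ := hbd (Pi.single ⟨0, hn⟩ α) β
  have hsum : (∑ i, ((Pi.single (⟨0, hn⟩ : Fin n) α : Fin n → ℕ) i : ℝ)) = α := by
    rw [← Nat.cast_sum, Finset.sum_pi_single']
    simp
  have hmix : ∀ x ξ, ‖pdSeq ((L.map (unitE n)).map fun v => ((0 : En n), v)) σ' (x, ξ)‖ ≤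
      |C₀| * (1 + ‖ξ‖) ^ M := by
    intro x ξ
    have h1 := hC₀ x ξ
    rw [hsum, mixD, dirList_single, dirList_map, pdSeq_perm List.perm_append_comm hs,
      pdSeq_append] at h1
    rw [hσ', List.map_replicate, List.map_map]
    have h2 : m - ρ * (∑ i, (β i : ℝ)) + δ * α = M := by rw [hM]; ring
    rw [h2] at h1
    refine (le_of_eq ?_).trans (h1.trans ?_)
    · rfl
    · gcongr
      exact le_abs_self _
  have hdiff := dSeq_bound (E := En n) M (L.map (unitE n))
    (by
      intro v hv
      obtain ⟨i, _, rfl⟩ := List.mem_map.1 hv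
      exact (unitE_norm i).le) |C₀| (abs_nonneg _) σ' hs' hmix
  set D : ℝ := |C₀| * ((2 : ℝ) ^ |M|) ^ (L.map (unitE n)).length with hD
  have hD0 : 0 ≤ D := by positivity
  refine ⟨D * (∫ ξ : En n, (1 + ‖ξ‖) ^ |M| * ‖Ψ ξ‖) * ∫ x, ‖Φα x‖, fun j k k' => ?_⟩
  set r : ℝ := (2 : ℝ) ^ j with hr
  have hr0 : 0 < r := by positivity
  set c : ℝ := (2 : ℝ) ^ ((n * j : ℝ) / 2) with hc
  have hc0 : 0 < c := by positivity
  set W : En n → ℂ := fun x => (-(r : ℂ)⁻¹) ^ α * ((c : ℂ) * Φα (r • x - intVec n k)) with hW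
  have hWc : Continuous W :=
    continuous_const.mul (continuous_const.mul (Φα.continuous.comp (by fun_prop)))
  have hWi : Integrable W :=
    ((schwartz_scale_integrable Φα hr0.ne' (intVec n k)).const_mul _).const_mul _
  have hfun : (fun k'' : Fin n → ℤ => ∫ ξ : En n, ∫ x : En n, σ (x, ξ) *
            ((c : ℂ) * pdSeq (List.replicate α e) (⇑Φα) (r • x - intVec n k)) *
            Ψ (ξ - intVec n k'')) = fun k'' => II W Ψ σ' (intVec n k'') := by
    funext k''
    rw [← integral_add_right_eq_self _ (intVec n k'')]
    unfold II
    congr 1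
    funext ξ
    simp only [add_sub_cancel_right]
    have hsl : ContDiff ℝ (⊤ : ℕ∞) (fun x : En n => σ (x, ξ + intVec n k'')) :=
      hs.comp (contDiff_id.prodMk contDiff_const)
    have h1 := ibp_iter Φα hr0.ne' (intVec n k) e α _ hsl (by
      intro l
      obtain ⟨C, M, h⟩ := hx l
      refine ⟨C * (1 + ‖ξ + intVec n k''‖) ^ M, fun x => ?_⟩
      rw [pdSeq_slice hs]
      exact h x _)
    rw [pdSeq_slice hs] at h1
    have h2 : ∀ x, σ (x, ξ + intVec n k'') *
        ((c : ℂ) * pdSeq (List.replicate α e) (⇑Φα) (r • x - intVec n k)) * Ψ ξ =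
        ((c : ℂ) * Ψ ξ) * (σ (x, ξ + intVec n k'') *
          pdSeq (List.replicate α e) (⇑Φα) (r • x - intVec n k)) := fun x => by ring
    have h3 : ∀ x, σ' (x, ξ + intVec n k'') * W x * Ψ ξ =
        ((c : ℂ) * Ψ ξ * (-(r : ℂ)⁻¹) ^ α) *
          (σ' (x, ξ + intVec n k'') * Φα (r • x - intVec n k)) := fun x => by
      simp only [hW]; ring
    simp only [h2, h3]
    rw [integral_const_mul, integral_const_mul, h1, ← mul_assoc]
  rw [hfun, fdiffM_eq, fdiff_II hTC hWc hWi]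
  refine (II_bound hD0 hdiff hWi Ψ (intVec n k')).trans (le_of_eq ?_)
  have hWint : ∫ x, ‖W x‖ = (2 : ℝ) ^ ((-(n : ℝ) / 2 - α) * j) * ∫ x, ‖Φα x‖ := by
    have h1 : ∀ x, ‖W x‖ = (r⁻¹ ^ α * c) * ‖Φα (r • x - intVec n k)‖ := by
      intro x
      simp only [hW, norm_mul, norm_pow, norm_neg, norm_inv, Complex.norm_real,
        Real.norm_of_nonneg hr0.le, Real.norm_of_nonneg hc0.le]
      ring
    simp only [h1]
    rw [integral_const_mul,
      Measure.integral_comp_smul volume (fun y : En n => ‖Φα (y - intVec n k)‖) r,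
      integral_sub_right_eq_self (fun y : En n => ‖Φα y‖), smul_eq_mul, ← mul_assoc]
    congr 1
    rw [finrank_euclideanSpace_fin, abs_of_pos (by positivity), hr, hc]
    have h2 : (0 : ℝ) < 2 := by norm_num
    have e1 : (((2 : ℝ) ^ j)⁻¹) ^ α = (2 : ℝ) ^ (-((j : ℝ) * α)) := by
      rw [Real.rpow_neg h2.le, Real.rpow_mul h2.le, Real.rpow_natCast, Real.rpow_natCast, inv_pow]
    have e2 : (((2 : ℝ) ^ j) ^ n)⁻¹ = (2 : ℝ) ^ (-((j : ℝ) * n)) := by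
      rw [Real.rpow_neg h2.le, Real.rpow_mul h2.le, Real.rpow_natCast, Real.rpow_natCast]
    rw [e1, e2, ← Real.rpow_add h2, ← Real.rpow_add h2]
    congr 1
    ring
  rw [hWint]
  ring
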